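/- Let σ be a partition of the set of all primes. The class of σ-nilpotent finite groups is closed under subgroups, homomorphic images, and products of normal σ-nilpotent subgroups. Moreover, if E is a normal subgroup of a finite group G and E/(E ∩ Φ(G)) is σ-nilpotent, then E is σ-nilpotent. -/

import Mathlib

open Subgroup
open scoped Pointwise

section Defs

variable {ι : Type*}

/-- `σ` is a partition of the set of all primes. -/
structure IsPrimePartition (σ : ι → Set ℕ) : Prop where
  prime_of_mem : ∀ i p, p ∈ σ i → p.Prime
  existsUnique_mem : ∀ p : ℕ, p.Prime → ∃! i, p ∈ σ i

/-- every prime dividing `n` lies in the block `σ i`. -/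
def IsSigmaNumber (σ : ι → Set ℕ) (i : ι) (n : ℕ) : Prop :=
  ∀ p : ℕ, p.Prime → p ∣ n → p ∈ σ i

/-- `G` is a `σ i`-group. -/
def IsSigmaIGroup (σ : ι → Set ℕ) (i : ι) (G : Type*) [Group G] : Prop :=
  IsSigmaNumber σ i (Nat.card G)

/-- `G` is σ-primary: it is a `σ i`-group for some `i`. -/
def IsSigmaPrimary (σ : ι → Set ℕ) (G : Type*) [Group G] : Prop :=
  ∃ i, IsSigmaIGroup σ i G

/-- `G` is σ-nilpotent: `G` is the internal direct product of normal
σ-primary subgroups (one `σ i`-subgroup for each block). -/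
def IsSigmaNilpotent (σ : ι → Set ℕ) (G : Type*) [Group G] : Prop :=
  ∃ H : ι → Subgroup G, (∀ i, (H i).Normal) ∧ (∀ i, IsSigmaIGroup σ i ↥(H i)) ∧
    iSupIndep H ∧ iSup H = ⊤

/-- One step in a σ-subnormal chain: `A ≤ B` and either `A` is normal in `B` or
`B/(A_B)` (quotient by the normal core of `A` in `B`) is σ-primary. -/
def SigmaSubnormalStep (σ : ι → Set ℕ) {G : Type*} [Group G] (A B : Subgroup G) : Prop :=
  A ≤ B ∧ (((A.subgroupOf B).Normal) ∨
    IsSigmaPrimary σ (↥B ⧸ (A.subgroupOf B).normalCore))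

/-- `A` is σ-subnormal in `G`. -/
def IsSigmaSubnormal (σ : ι → Set ℕ) {G : Type*} [Group G] (A : Subgroup G) : Prop :=
  ∃ n, ∃ C : Fin (n + 1) → Subgroup G, C 0 = A ∧ C (Fin.last n) = ⊤ ∧
    ∀ k : Fin n, SigmaSubnormalStep σ (C k.castSucc) (C k.succ)

/-- `A` is subnormal in `G`. -/
def IsSubnormalSub {G : Type*} [Group G] (A : Subgroup G) : Prop :=
  ∃ n, ∃ C : Fin (n + 1) → Subgroup G, C 0 = A ∧ C (Fin.last n) = ⊤ ∧
    ∀ k : Fin n, C k.castSucc ≤ C k.succ ∧ ((C k.castSucc).subgroupOf (C k.succ)).Normal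

/-- `M` is a modular subgroup of `G`: a modular element of the subgroup lattice. -/
def IsModularSubgroup {G : Type*} [Group G] (M : Subgroup G) : Prop :=
  (∀ X Z : Subgroup G, X ≤ Z → X ⊔ (M ⊓ Z) = (X ⊔ M) ⊓ Z) ∧
  (∀ Y Z : Subgroup G, M ≤ Z → M ⊔ (Y ⊓ Z) = (M ⊔ Y) ⊓ Z)

/-- `A` is submodular in `G`: there is a chain from `A` to `G` with each
term modular in the next. -/
def IsSubmodular {G : Type*} [Group G] (A : Subgroup G) : Prop :=
  ∃ n, ∃ C : Fin (n + 1) → Subgroup G, C 0 = A ∧ C (Fin.last n) = ⊤ ∧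
    ∀ k : Fin n, C k.castSucc ≤ C k.succ ∧
      IsModularSubgroup ((C k.castSucc).subgroupOf (C k.succ))

/-- `H` is a Hall `σ i`-subgroup of `G`. -/
def IsHallSigmaI (σ : ι → Set ℕ) (i : ι) {G : Type*} [Group G] (H : Subgroup G) : Prop :=
  IsSigmaNumber σ i (Nat.card H) ∧ ∀ p : ℕ, p.Prime → p ∣ H.index → p ∉ σ i

/-- `G` is σ-full: it has a Hall `σ i`-subgroup for every `σ i ∈ σ(G)`. -/
def IsSigmaFull (σ : ι → Set ℕ) (G : Type*) [Group G] : Prop :=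
  ∀ i, (∃ p : ℕ, p.Prime ∧ p ∈ σ i ∧ p ∣ Nat.card G) →
    ∃ H : Subgroup G, IsHallSigmaI σ i H

/-- Two subgroups permute. -/
def Permutes {G : Type*} [Group G] (A B : Subgroup G) : Prop :=
  (A : Set G) * (B : Set G) = (B : Set G) * (A : Set G)

/-- `A` is σ-permutable in `G`: it permutes with every Hall `σ i`-subgroup of `G`
(hence with all their conjugates). -/
def IsSigmaPermutable (σ : ι → Set ℕ) {G : Type*} [Group G] (A : Subgroup G) : Prop :=
  ∀ i, ∀ H : Subgroup G, IsHallSigmaI σ i H → Permutes A H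

/-- `A` is quasinormal (permutable) in `G`. -/
def IsQuasinormal {G : Type*} [Group G] (A : Subgroup G) : Prop :=
  ∀ B : Subgroup G, Permutes A B

/-- `A` is σ-quasinormal in `G`: modular and σ-subnormal. -/
def IsSigmaQuasinormal (σ : ι → Set ℕ) {G : Type*} [Group G] (A : Subgroup G) : Prop :=
  IsModularSubgroup A ∧ IsSigmaSubnormal σ A

/-- σ-permutability is a transitive relation on `G`. -/
def IsPSigmaTGroup (σ : ι → Set ℕ) (G : Type*) [Group G] : Prop :=
  ∀ K H : Subgroup G, H ≤ K → IsSigmaPermutable σ (H.subgroupOf K) →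
    IsSigmaPermutable σ K → IsSigmaPermutable σ H

/-- `H/K` is a chief factor of `G`. -/
def IsChiefFactor (G : Type*) [Group G] (K H : Subgroup G) : Prop :=
  K.Normal ∧ H.Normal ∧ K < H ∧
    ∀ N : Subgroup G, N.Normal → K ≤ N → N ≤ H → N = K ∨ N = H

/-- `G` is σ-soluble: every chief factor of `G` is σ-primary. -/
def IsSigmaSoluble (σ : ι → Set ℕ) (G : Type*) [Group G] : Prop :=
  ∀ K H : Subgroup G, ∀ hc : IsChiefFactor G K H,
    letI := hc.1; IsSigmaPrimary σ (↥H ⧸ K.subgroupOf H)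

/-- The σ-nilpotent residual `G^{𝔑_σ}` of `G`. -/
def sigmaNilpotentResidual (σ : ι → Set ℕ) (G : Type*) [Group G] : Subgroup G :=
  sInf {N : Subgroup G | ∃ h : N.Normal, letI := h; IsSigmaNilpotent σ (G ⧸ N)}

/-- The σ-soluble residual `G^{𝔖_σ}` of `G`. -/
def sigmaSolubleResidual (σ : ι → Set ℕ) (G : Type*) [Group G] : Subgroup G :=
  sInf {N : Subgroup G | ∃ h : N.Normal, letI := h; IsSigmaSoluble σ (G ⧸ N)}

/-- `G` is a σ-SC-group: every chief factor of `G` below `G^{𝔑_σ}` is simple. -/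
def IsSigmaSCGroup (σ : ι → Set ℕ) (G : Type*) [Group G] : Prop :=
  ∀ K H : Subgroup G, ∀ hc : IsChiefFactor G K H, H ≤ sigmaNilpotentResidual σ G →
    letI := hc.1; IsSimpleGroup (↥H ⧸ K.subgroupOf H)

/-- `G` is σ-supersoluble: every chief factor of `G` below `G^{𝔑_σ}` is cyclic. -/
def IsSigmaSupersoluble (σ : ι → Set ℕ) (G : Type*) [Group G] : Prop :=
  ∀ K H : Subgroup G, ∀ hc : IsChiefFactor G K H, H ≤ sigmaNilpotentResidual σ G →
    letI := hc.1; IsCyclic (↥H ⧸ K.subgroupOf H)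

/-- The σ-supersoluble residual `G^{𝔘_σ}` of `G`. -/
def sigmaSupersolubleResidual (σ : ι → Set ℕ) (G : Type*) [Group G] : Subgroup G :=
  sInf {N : Subgroup G | ∃ h : N.Normal, letI := h; IsSigmaSupersoluble σ (G ⧸ N)}

/-- The soluble radical `G_𝔖`: the largest soluble normal subgroup of `G`. -/
def solubleRadical (G : Type*) [Group G] : Subgroup G :=
  sSup {N : Subgroup G | N.Normal ∧ IsSolvable ↥N}

/-- `O_{σ i}(G)`: the largest normal `σ i`-subgroup of `G`. -/
def sigmaCore (σ : ι → Set ℕ) (i : ι) (G : Type*) [Group G] : Subgroup G :=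
  sSup {N : Subgroup G | N.Normal ∧ IsSigmaIGroup σ i ↥N}

/-- `O^{σ i}(G)`: the smallest normal subgroup of `G` with `σ i`-quotient. -/
def sigmaIResidual (σ : ι → Set ℕ) (i : ι) (G : Type*) [Group G] : Subgroup G :=
  sInf {N : Subgroup G | ∃ h : N.Normal, letI := h; IsSigmaIGroup σ i (G ⧸ N)}

end Defs


section Helpers

/-- every prime dividing `n` lies in `π`. -/
def PiNum (π : Set ℕ) (n : ℕ) : Prop := ∀ p : ℕ, p.Prime → p ∣ n → p ∈ π

theorem PiNum.of_dvd {π : Set ℕ} {m n : ℕ} (h : PiNum π n) (hd : m ∣ n) : PiNum π m :=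
  fun p hp hm => h p hp (hm.trans hd)

theorem PiNum.mul {π : Set ℕ} {m n : ℕ} (h : PiNum π m) (h' : PiNum π n) : PiNum π (m * n) :=
  fun p hp hm => (hp.dvd_mul.1 hm).elim (h p hp) (h' p hp)

theorem PiNum.coprime {π : Set ℕ} {m n : ℕ} (h : PiNum π m) (h' : PiNum πᶜ n) :
    Nat.Coprime m n :=
  Nat.coprime_of_dvd fun p hp hm hn => h' p hp hn (h p hp hm)

theorem PiNum.one (π : Set ℕ) : PiNum π 1 :=
  fun p hp h => absurd (Nat.dvd_one.1 h) hp.one_lt.ne'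

/-- the product of two normal π-subgroups is a π-group -/
theorem PiNum.sup {π : Set ℕ} {G : Type*} [Group G] {A B : Subgroup G} [A.Normal]
    (hA : PiNum π (Nat.card A)) (hB : PiNum π (Nat.card B)) :
    PiNum π (Nat.card (A ⊔ B : Subgroup G)) := by
  have h1 : (⊥ : Subgroup G).relIndex A * A.relIndex (A ⊔ B) = (⊥ : Subgroup G).relIndex (A ⊔ B) :=
    relIndex_mul_relIndex _ _ _ bot_le le_sup_left
  rw [relIndex_bot_left, relIndex_bot_left, relIndex_sup_left] at h1
  rw [← h1]
  exact hA.mul (hB.of_dvd (relIndex_dvd_card A B))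

/-- the π-core -/
theorem exists_core (π : Set ℕ) (G : Type*) [Group G] [Finite G] :
    ∃ M : Subgroup G, M.Normal ∧ PiNum π (Nat.card M) ∧
      ∀ N : Subgroup G, N.Normal → PiNum π (Nat.card N) → N ≤ M := by
  have hf : Set.Finite {M : Subgroup G | M.Normal ∧ PiNum π (Nat.card M)} := Set.toFinite _
  have hne : {M : Subgroup G | M.Normal ∧ PiNum π (Nat.card M)}.Nonempty :=
    ⟨⊥, inferInstance, by simpa using PiNum.one π⟩
  obtain ⟨M, hM⟩ := hf.exists_maximal hne
  obtain ⟨hMn, hMp⟩ := hM.prop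
  refine ⟨M, hMn, hMp, fun N hN hNp => ?_⟩
  have : M ⊔ N ≤ M := hM.2 ⟨inferInstance, hMp.sup hNp⟩ le_sup_left
  exact le_sup_right.trans this

/-- normal Hall subgroup for π -/
def NHall (π : Set ℕ) {G : Type*} [Group G] (N : Subgroup G) : Prop :=
  N.Normal ∧ PiNum π (Nat.card N) ∧ PiNum πᶜ N.index

theorem sn_of_iSup {ι : Type*} {σ : ι → Set ℕ} (hσ : IsPrimePartition σ)
    {G : Type*} [Group G] [Finite G] (H : ι → Subgroup G) (hn : ∀ i, (H i).Normal)
    (hc : ∀ i, PiNum (σ i) (Nat.card (H i))) (ht : iSup H = ⊤) : IsSigmaNilpotent σ G := by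
  refine ⟨H, hn, hc, fun i => ?_, ht⟩
  obtain ⟨M, _, hM, hmax⟩ := exists_core (σ i)ᶜ G
  have hle : (⨆ j, ⨆ (_ : j ≠ i), H j) ≤ M := by
    refine iSup₂_le fun j hj => hmax _ (hn j) fun p hp hd hpi => ?_
    exact hj ((hσ.existsUnique_mem p hp).unique (hc j p hp hd) hpi)
  refine Disjoint.mono_right hle ?_
  exact disjoint_of_coprime_natCard ((hc i).coprime hM)

theorem sn_iff {ι : Type*} {σ : ι → Set ℕ} (hσ : IsPrimePartition σ)
    {G : Type*} [Group G] [Finite G] :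
    IsSigmaNilpotent σ G ↔ ∀ i, ∃ N : Subgroup G, NHall (σ i) N := by
  constructor
  · rintro ⟨H, hn, hc, -, ht⟩ i
    have := hn i
    refine ⟨H i, hn i, hc i, ?_⟩
    obtain ⟨M, _, hM, hmax⟩ := exists_core (σ i)ᶜ G
    have hle : H i ⊔ M = ⊤ := by
      rw [eq_top_iff, ← ht]
      refine iSup_le fun j => ?_
      by_cases hj : j = i
      · subst hj; exact le_sup_left
      · refine le_trans (hmax _ (hn j) fun p hp hd hpi => ?_) le_sup_right
        exact hj ((hσ.existsUnique_mem p hp).unique (hc j p hp hd) hpi)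
    have h2 : (H i).index = (H i).relIndex M := by
      rw [← relIndex_top_right, ← hle, relIndex_sup_left]
    rw [h2]
    exact hM.of_dvd (relIndex_dvd_card _ _)
  · intro h
    choose N hN using h
    refine sn_of_iSup hσ N (fun i => (hN i).1) (fun i => (hN i).2.1) ?_
    rw [← index_eq_one]
    by_contra hne
    obtain ⟨p, hp, hd⟩ := Nat.exists_prime_and_dvd hne
    obtain ⟨i, hi, -⟩ := hσ.existsUnique_mem p hp
    exact (hN i).2.2 p hp (hd.trans (index_dvd_of_le (le_iSup N i))) hi

theorem NHall.subgroupOf {π : Set ℕ} {G : Type*} [Group G] [Finite G] {N : Subgroup G}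
    (h : NHall π N) (K : Subgroup G) : NHall π (N.subgroupOf K) := by
  have := h.1
  refine ⟨inferInstance, h.2.1.of_dvd ?_, h.2.2.of_dvd (relIndex_dvd_index_of_normal N K)⟩
  rw [← card_subtype K (N.subgroupOf K)]
  rw [subgroupOf_map_subtype]
  exact card_dvd_of_le inf_le_left

theorem NHall.map {π : Set ℕ} {G H : Type*} [Group G] [Group H] {N : Subgroup G}
    (h : NHall π N) (f : G →* H) (hf : Function.Surjective f) : NHall π (N.map f) :=
  ⟨h.1.map f hf, h.2.1.of_dvd (card_map_dvd N f), h.2.2.of_dvd (index_map_dvd N hf)⟩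

/-- elements of a normal Hall subgroup -/
theorem NHall.mem_iff {π : Set ℕ} {G : Type*} [Group G] {N : Subgroup G}
    (h : NHall π N) (x : G) : x ∈ N ↔ ∃ n, PiNum π n ∧ x ^ n = 1 := by
  have := h.1
  constructor
  · intro hx
    exact ⟨Nat.card N, h.2.1, by
      have := pow_card_eq_one' (x := (⟨x, hx⟩ : N))
      exact congrArg Subtype.val this⟩
  · rintro ⟨n, hn, hx⟩
    rw [← QuotientGroup.eq_one_iff, ← orderOf_eq_one_iff]
    apply Nat.eq_one_of_dvd_coprimes (hn.coprime h.2.2)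
    · apply orderOf_dvd_of_pow_eq_one
      rw [← QuotientGroup.mk_pow, hx, QuotientGroup.mk_one]
    · rw [index_eq_card]
      exact orderOf_dvd_natCard _

theorem NHall.map_normal {π : Set ℕ} {G : Type*} [Group G] {E : Subgroup G} (hE : E.Normal)
    {D : Subgroup G} (hD : D.Normal) {N : Subgroup (E ⧸ D.subgroupOf E)} (h : NHall π N) :
    ((N.comap (QuotientGroup.mk' (D.subgroupOf E))).map E.subtype).Normal := by
  have key : ∀ x : G, x ∈ (N.comap (QuotientGroup.mk' (D.subgroupOf E))).map E.subtype ↔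
      x ∈ E ∧ ∃ n, PiNum π n ∧ x ^ n ∈ D := by
    intro x
    constructor
    · rintro ⟨y, hy, rfl⟩
      refine ⟨y.2, ?_⟩
      obtain ⟨n, hn, h1⟩ := (h.mem_iff _).1 (mem_comap.1 hy)
      refine ⟨n, hn, ?_⟩
      rw [← map_pow, QuotientGroup.mk'_apply, QuotientGroup.eq_one_iff] at h1
      simpa [mem_subgroupOf] using h1
    · rintro ⟨hx, n, hn, h1⟩
      refine ⟨⟨x, hx⟩, ?_, rfl⟩
      refine mem_comap.2 ((h.mem_iff _).2 ⟨n, hn, ?_⟩)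
      rw [← map_pow, QuotientGroup.mk'_apply, QuotientGroup.eq_one_iff]
      simpa [mem_subgroupOf] using h1
  refine ⟨fun x hx g => ?_⟩
  rw [key] at hx ⊢
  obtain ⟨hx, n, hn, h1⟩ := hx
  refine ⟨hE.conj_mem _ hx g, n, hn, ?_⟩
  rw [conj_pow]
  exact hD.conj_mem _ h1 g

theorem NHall.map_normal' {π : Set ℕ} {G : Type*} [Group G] {E : Subgroup G} (hE : E.Normal)
    {N : Subgroup E} (h : NHall π N) : (N.map E.subtype).Normal := by
  refine ⟨?_⟩
  rintro _ ⟨y, hy, rfl⟩ g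
  refine ⟨⟨g * y * g⁻¹, hE.conj_mem _ y.2 g⟩, ?_, rfl⟩
  obtain ⟨n, hn, h1⟩ := (h.mem_iff _).1 hy
  refine (h.mem_iff _).2 ⟨n, hn, ?_⟩
  rw [Subtype.ext_iff] at h1 ⊢
  simp only [SubmonoidClass.mk_pow, SubmonoidClass.coe_pow, conj_pow] at h1 ⊢
  simp [h1]

/-- complements of an abelian normal Hall subgroup are conjugate -/
theorem abelian_conj {V : Type*} [Group V] [Finite V] {D : Subgroup V} [D.Normal]
    [IsMulCommutative D] (hco : Nat.Coprime (Nat.card D) D.index) {S T : Subgroup V}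
    (hS : IsComplement' S D) (hT : IsComplement' T D) :
    ∃ d ∈ D, ∀ x, x ∈ T ↔ d⁻¹ * x * d ∈ S := by
  have stab : ∀ {S : Subgroup V}, IsComplement' S D →
      ∃ α : D.QuotientDiff, MulAction.stabilizer V α = S := by
    intro S hS
    let t : D.LeftTransversal := ⟨(S : Set V), hS⟩
    let α : D.QuotientDiff := Quotient.mk'' t
    refine ⟨α, ?_⟩
    have hle : S ≤ MulAction.stabilizer V α := by
      intro s hs
      rw [MulAction.mem_stabilizer_iff]
      have : MulOpposite.op s⁻¹ • t = t := by
        apply Subtype.ext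
        change MulOpposite.op s⁻¹ • (S : Set V) = S
        exact op_smul_coe_set (S.inv_mem hs)
      change Quotient.mk'' (MulOpposite.op s⁻¹ • t) = α
      rw [this]
    have hc := (isComplement'_stabilizer_of_coprime (α := α) hco).symm.card_mul_card
    have hc' := hS.card_mul_card
    refine (eq_of_le_of_card_ge hle ?_).symm
    exact (Nat.eq_of_mul_eq_mul_right Nat.card_pos (hc.trans hc'.symm)).le
  obtain ⟨α, hα⟩ := stab hS
  obtain ⟨β, hβ⟩ := stab hT
  obtain ⟨d, hd⟩ := exists_smul_eq hco α β
  refine ⟨d, d.2, fun x => ?_⟩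
  rw [← hα, ← hβ, MulAction.mem_stabilizer_iff, MulAction.mem_stabilizer_iff, ← hd, mul_smul,
    mul_smul, inv_smul_eq_iff]
  rfl

theorem abelian_frattini {G : Type*} [Group G] [Finite G] {D V : Subgroup G} [D.Normal]
    [V.Normal] [IsMulCommutative D] (hDV : D ≤ V) (hF : D ≤ frattini G)
    (hco : Nat.Coprime (Nat.card D) (D.relIndex V)) :
    ∃ S : Subgroup G, S.Normal ∧ S ≤ V ∧ Nat.card S = D.relIndex V ∧
      S.relIndex V = Nat.card D := by
  have hcard : Nat.card (D.subgroupOf V) = Nat.card D :=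
    Nat.card_congr (subgroupOfEquivOfLe hDV).toEquiv
  have hco' : Nat.Coprime (Nat.card (D.subgroupOf V)) (D.subgroupOf V).index := by
    rw [hcard]; exact hco
  have : IsMulCommutative (D.subgroupOf V) := inferInstance
  obtain ⟨S, hS⟩ := exists_left_complement'_of_coprime hco'
  have hSc : Nat.card S = D.relIndex V := hS.symm.card_right
  have hSi : S.index = Nat.card D := by rw [hS.symm.index_eq_card, hcard]
  refine ⟨S.map V.subtype, ?_, ?_, ?_, ?_⟩
  · rw [← normalizer_eq_top_iff]
    apply frattini_nongenerating
    rw [eq_top_iff]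
    intro g _
    have hT : IsComplement' (S.map (MulAut.conjNormal g : MulAut V).toMonoidHom)
        (D.subgroupOf V) := by
      have hc : Nat.card (S.map (MulAut.conjNormal g : MulAut V).toMonoidHom) = Nat.card S :=
        card_map_of_injective (MulAut.conjNormal g : MulAut V).injective
      apply isComplement'_of_coprime
      · rw [hc]; exact hS.card_mul_card
      · rw [hc, hSc]; exact hco'.symm
    obtain ⟨d, hdD, hd⟩ := abelian_conj hco' hS hT
    have hdg : (d : G)⁻¹ * g ∈ normalizer ((S.map V.subtype : Subgroup G) : Set G) := by
      have hmem : ∀ x : G, x ∈ S.map V.subtype ↔ ∃ hx : x ∈ V, (⟨x, hx⟩ : V) ∈ S := by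
        intro x
        constructor
        · rintro ⟨y, hy, rfl⟩
          exact ⟨y.2, hy⟩
        · rintro ⟨hx, hy⟩
          exact ⟨_, hy, rfl⟩
      have hconj : ∀ v : V, v ∈ S ↔ d⁻¹ * (MulAut.conjNormal g v) * d ∈ S := by
        intro v
        rw [← hd]
        exact (mem_map_iff_mem (f := (MulAut.conjNormal g : MulAut V).toMonoidHom)
          (MulAut.conjNormal g : MulAut V).injective).symm
      rw [mem_normalizer_iff]
      intro h
      rw [hmem, hmem]
      have heq : ∀ hh : h ∈ V, ((d⁻¹ * (MulAut.conjNormal g ⟨h, hh⟩) * d : V) : G) =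
          (d : G)⁻¹ * g * h * ((d : G)⁻¹ * g)⁻¹ := by
        intro hh
        simp [MulAut.conjNormal_apply, mul_assoc]
      have hV : V.Normal := inferInstance
      constructor
      · rintro ⟨hh, hs⟩
        have := (hconj _).1 hs
        rw [← heq hh]
        exact ⟨Subtype.property _, this⟩
      · rintro ⟨hh, hs⟩
        have hhV : h ∈ V := by
          have := hV.conj_mem _ hh ((d : G)⁻¹ * g)⁻¹
          simpa [mul_assoc] using this
        refine ⟨hhV, (hconj _).2 ?_⟩
        convert hs using 1
        exact Subtype.ext (heq hhV)
    have hdF : (d : G) ∈ frattini G := hF hdD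
    have := mul_mem (mem_sup_right (S := normalizer ((S.map V.subtype : Subgroup G) : Set G)) hdF)
      (mem_sup_left (T := frattini G) hdg)
    simpa using this
  · exact map_subtype_le S
  · rw [card_map_of_injective V.subtype_injective, hSc]
  · rw [relIndex, subgroupOf, comap_map_eq_self_of_injective V.subtype_injective, hSi]

theorem relIndex_mk {G : Type*} [Group G] (Z K : Subgroup G) [Z.Normal] :
    Z.relIndex K = Nat.card (K.map (QuotientGroup.mk' Z)) := by
  have h := relIndex_ker K (QuotientGroup.mk' Z)
  have hk := QuotientGroup.ker_mk' Z
  exact (congrArg (fun A : Subgroup G => A.relIndex K) hk.symm).trans h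

theorem solvable_step {π : Set ℕ} {G : Type*} [Group G] [Finite G] (n : ℕ) :
    ∀ (D V : Subgroup G), D.Normal → V.Normal → D ≤ V → D ≤ frattini G →
      PiNum πᶜ (Nat.card D) → PiNum π (D.relIndex V) → Nat.card D ≤ n →
    ∃ S : Subgroup G, S.Normal ∧ S ≤ V ∧ PiNum π (Nat.card S) ∧ PiNum πᶜ (S.relIndex V) := by
  induction n with
  | zero =>
    intro D V _ _ _ _ _ _ h
    exact absurd h (by simpa using (Nat.card_pos (α := D)).ne')
  | succ n ih =>
    intro D V hDn hVn hDV hF hD hV hn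
    by_cases hbot : D = ⊥
    · subst hbot
      refine ⟨V, hVn, le_rfl, by simpa using hV, by simpa using PiNum.one _⟩
    have := frattini_nilpotent (G := G)
    have hsol : Group.IsSolvable D :=
      Group.isSolvable_of_isSolvable_injective (f := inclusion hF) (inclusion_injective hF)
    have : Nontrivial D := (nontrivial_iff_ne_bot D).2 hbot
    have hZ : ⁅D, D⁆ < D := by
      rw [← D.range_subtype, MonoidHom.range_eq_map, ← map_commutator, map_subtype_lt_map_subtype]
      exact Group.IsSolvable.commutator_lt_top_of_nontrivial D
    set Z := ⁅D, D⁆ with hZdef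
    have hZn : Z.Normal := commutator_normal D D
    let q := QuotientGroup.mk' Z
    have hq : Function.Surjective q := QuotientGroup.mk'_surjective Z
    have hker : q.ker = Z := QuotientGroup.ker_mk' Z
    have h1 : (D.map q).Normal := hDn.map q hq
    have h2 : (V.map q).Normal := hVn.map q hq
    have h3 : IsMulCommutative (D.map q) := by
      have hb : ⁅D.map q, D.map q⁆ = ⊥ := by
        rw [← map_commutator, Subgroup.map_eq_bot_iff, hker]
      rw [commutator_eq_bot_iff_le_centralizer] at hb
      exact IsMulCommutative.of_setLike_mul_comm fun a ha b hb' =>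
        mem_centralizer_iff.1 (hb hb') a ha
    have h4 : D.map q ≤ frattini (G ⧸ Z) :=
      map_le_iff_le_comap.2 (hF.trans (frattini_le_comap_frattini_of_surjective hq))
    have hr : (D.map q).relIndex (V.map q) = D.relIndex V := by
      rw [relIndex_map_map, hker, sup_eq_left.2 hZ.le, sup_eq_left.2 (hZ.le.trans hDV)]
    have h5 : PiNum πᶜ (Nat.card (D.map q)) := hD.of_dvd (card_map_dvd D q)
    have h6 : Nat.Coprime (Nat.card (D.map q)) ((D.map q).relIndex (V.map q)) := by
      rw [hr]; exact (hV.coprime h5).symm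
    obtain ⟨S, hSn, hSV, hSc, hSi⟩ := abelian_frattini (map_mono hDV) h4 h6
    have hSn' : (S.comap q).Normal := hSn.comap q
    have hZS : Z ≤ S.comap q := hker.symm.le.trans (ker_le_comap q S)
    have hSV' : S.comap q ≤ V := by
      refine (comap_mono hSV).trans ?_
      rw [comap_map_eq, hker, sup_eq_left.2 (hZ.le.trans hDV)]
    have hmS : (S.comap q).map q = S := map_comap_eq_self_of_surjective hq S
    have h7 : Z.relIndex (S.comap q) = D.relIndex V := by
      rw [← hr, ← hSc, relIndex_mk, hmS]
    have h8 : (S.comap q).relIndex V = Nat.card (D.map q) := by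
      rw [relIndex_comap, hSi]
    have hlt : Nat.card Z < Nat.card D := by
      by_contra hge
      exact hZ.ne (eq_of_le_of_card_ge hZ.le (not_lt.1 hge))
    obtain ⟨T, hTn, hTS, hTc, hTi⟩ := ih Z (S.comap q) hZn hSn' hZS (hZ.le.trans hF)
      (hD.of_dvd (card_dvd_of_le hZ.le)) (by rw [h7]; exact hV) (by omega)
    refine ⟨T, hTn, hTS.trans hSV', hTc, ?_⟩
    rw [← relIndex_mul_relIndex _ _ _ hTS hSV', h8]
    exact hTi.mul h5

theorem nilpotent_split (π : Set ℕ) {D : Type*} [Group D] [Finite D] [Group.IsNilpotent D] :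
    ∃ B : Subgroup D, NHall πᶜ B := by
  obtain ⟨A, hAn, hA, hAmax⟩ := exists_core π D
  obtain ⟨B, hBn, hB, hBmax⟩ := exists_core πᶜ D
  have htop : B ⊔ A = ⊤ := by
    rw [← index_eq_one]
    by_contra hne
    obtain ⟨p, hp, hd⟩ := Nat.exists_prime_and_dvd hne
    have : Fact p.Prime := ⟨hp⟩
    obtain ⟨P⟩ : Nonempty (Sylow p D) := inferInstance
    have hPn : (P : Subgroup D).Normal := inferInstance
    have hPp : PiNum {p} (Nat.card P) := by
      intro r hr hrd
      obtain ⟨k, hk⟩ := IsPGroup.iff_card.1 P.isPGroup'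
      rw [hk] at hrd
      exact (Nat.prime_dvd_prime_iff_eq hr hp).1 (hr.dvd_of_dvd_pow hrd)
    have hle : (P : Subgroup D) ≤ B ⊔ A := by
      by_cases hpi : p ∈ π
      · exact (hAmax P hPn fun r hr hrd => by rw [hPp r hr hrd]; exact hpi).trans le_sup_right
      · exact (hBmax P hPn fun r hr hrd => by rw [hPp r hr hrd]; exact hpi).trans le_sup_left
    exact P.not_dvd_index (hd.trans (index_dvd_of_le hle))
  refine ⟨B, hBn, hB, ?_⟩
  rw [compl_compl, ← relIndex_top_right, ← htop, relIndex_sup_left]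
  exact hA.of_dvd (relIndex_dvd_card _ _)

theorem frattini_hall {π : Set ℕ} {G : Type*} [Group G] [Finite G] {E : Subgroup G}
    (hE : E.Normal) {N : Subgroup (E ⧸ (frattini G).subgroupOf E)} (hN : NHall π N) :
    ∃ S : Subgroup E, NHall π S := by
  have hFn : (frattini G).Normal := inferInstance
  have hVn := hN.map_normal hE hFn
  set V0 := N.comap (QuotientGroup.mk' ((frattini G).subgroupOf E)) with hV0
  set V := V0.map E.subtype with hV
  have hVE : V ≤ E := map_subtype_le V0
  have hVi : V.relIndex E = N.index := by
    rw [relIndex, hV, subgroupOf, comap_map_eq_self_of_injective E.subtype_injective, hV0,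
      index_comap_of_surjective _ (QuotientGroup.mk'_surjective _)]
  have hFE : frattini G ⊓ E ≤ V := by
    rintro x ⟨hx, hxE⟩
    refine ⟨⟨x, hxE⟩, ?_, rfl⟩
    refine mem_comap.2 ?_
    have : QuotientGroup.mk' ((frattini G).subgroupOf E) ⟨x, hxE⟩ = 1 := by
      rw [QuotientGroup.mk'_apply, QuotientGroup.eq_one_iff]
      exact hx
    rw [this]
    exact N.one_mem
  set D := frattini G ⊓ E with hD
  have hDn : D.Normal := inferInstance
  have hDV : PiNum π (D.relIndex V) := by
    have : D.relIndex V = Nat.card N := by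
      rw [hD, ← subgroupOf_map_subtype, hV, relIndex_map_map_of_injective _ _ E.subtype_injective,
        relIndex_mk, hV0,
        map_comap_eq_self_of_surjective (QuotientGroup.mk'_surjective _)]
    rw [this]; exact hN.2.1
  have := frattini_nilpotent (G := G)
  have hnil : Group.IsNilpotent D :=
    Group.nilpotent_of_mulEquiv (subgroupOfEquivOfLe (inf_le_left : D ≤ frattini G))
  obtain ⟨B, hB⟩ := nilpotent_split π (D := D)
  have hBn := hB.map_normal' hDn
  have hBD : B.map D.subtype ≤ D := map_subtype_le B
  have hBi : (B.map D.subtype).relIndex D = B.index := by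
    rw [relIndex, subgroupOf, comap_map_eq_self_of_injective D.subtype_injective]
  have hB2 := hB.2.2
  rw [compl_compl] at hB2
  obtain ⟨S, hSn, hSV, hSc, hSi⟩ := solvable_step (π := π) _ (B.map D.subtype) V hBn hVn
    (hBD.trans hFE) (hBD.trans inf_le_left) (hB.2.1.of_dvd (card_map_dvd _ _))
    (by
      rw [← relIndex_mul_relIndex _ _ _ hBD hFE, hBi]
      exact hB2.mul hDV) le_rfl
  refine ⟨S.subgroupOf E, inferInstance, ?_, ?_⟩
  · rw [Nat.card_congr (subgroupOfEquivOfLe (hSV.trans hVE)).toEquiv]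
    exact hSc
  · change PiNum πᶜ (S.relIndex E)
    rw [← relIndex_mul_relIndex _ _ _ hSV hVE, hVi]
    exact hSi.mul hN.2.2

end Helpers

/-- The class of σ-nilpotent finite groups is closed under subgroups, homomorphic
images and products of normal subgroups; moreover if `E ⊴ G` and `E/(E ∩ Φ(G))` is
σ-nilpotent then `E` is σ-nilpotent. -/
theorem statement_3.{u, v} {ι : Type*} (σ : ι → Set ℕ) (hσ : IsPrimePartition σ) :
    (∀ (G : Type u) [Group G] [Finite G], IsSigmaNilpotent σ G →
        ∀ H : Subgroup G, IsSigmaNilpotent σ ↥H) ∧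
    (∀ (G : Type u) [Group G] [Finite G] (H : Type v) [Group H] [Finite H]
        (f : G →* H), Function.Surjective f → IsSigmaNilpotent σ G →
        IsSigmaNilpotent σ H) ∧
    (∀ (G : Type u) [Group G] [Finite G] (N₁ N₂ : Subgroup G), N₁.Normal → N₂.Normal →
        IsSigmaNilpotent σ ↥N₁ → IsSigmaNilpotent σ ↥N₂ →
        IsSigmaNilpotent σ ↥(N₁ ⊔ N₂)) ∧
    (∀ (G : Type u) [Group G] [Finite G] (E : Subgroup G), E.Normal →
        IsSigmaNilpotent σ (↥E ⧸ (frattini G).subgroupOf E) →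
        IsSigmaNilpotent σ ↥E) := by
  refine ⟨?_, ?_, ?_, ?_⟩
  · intro G _ _ h K
    rw [sn_iff hσ] at h ⊢
    intro i
    obtain ⟨N, hN⟩ := h i
    exact ⟨_, hN.subgroupOf K⟩
  · intro G _ _ H _ _ f hf h
    rw [sn_iff hσ] at h ⊢
    intro i
    obtain ⟨N, hN⟩ := h i
    exact ⟨_, hN.map f hf⟩
  · intro G _ _ N₁ N₂ hn₁ hn₂ h₁ h₂
    have aux : ∀ N : Subgroup G, N.Normal → IsSigmaNilpotent σ ↥N →
        ∃ H : ι → Subgroup G, (∀ i, (H i).Normal) ∧ (∀ i, PiNum (σ i) (Nat.card (H i))) ∧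
          iSup H = N := by
      rintro N hn h
      have h' := (sn_iff hσ).1 h
      choose H hH using h'
      refine ⟨fun i => (H i).map N.subtype, fun i => (hH i).map_normal' hn,
        fun i => (hH i).2.1.of_dvd (card_map_dvd _ _), ?_⟩
      have htop : iSup H = ⊤ := by
        rw [← index_eq_one]
        by_contra hne
        obtain ⟨p, hp, hd⟩ := Nat.exists_prime_and_dvd hne
        obtain ⟨i, hi, -⟩ := hσ.existsUnique_mem p hp
        exact (hH i).2.2 p hp (hd.trans (index_dvd_of_le (le_iSup H i))) hi
      rw [← Subgroup.map_iSup, htop, ← MonoidHom.range_eq_map, range_subtype]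
    obtain ⟨A, hA, hAc, hAt⟩ := aux N₁ hn₁ h₁
    obtain ⟨B, hB, hBc, hBt⟩ := aux N₂ hn₂ h₂
    have hle : ∀ i, A i ⊔ B i ≤ N₁ ⊔ N₂ := fun i =>
      sup_le_sup (hAt ▸ le_iSup A i) (hBt ▸ le_iSup B i)
    refine sn_of_iSup hσ (fun i => (A i ⊔ B i).subgroupOf (N₁ ⊔ N₂)) (fun i => ?_)
      (fun i => ?_) ?_
    · have := hA i
      have := hB i
      infer_instance
    · have := hA i
      rw [Nat.card_congr (subgroupOfEquivOfLe (hle i)).toEquiv]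
      exact (hAc i).sup (hBc i)
    · apply map_injective (N₁ ⊔ N₂).subtype_injective
      rw [Subgroup.map_iSup, ← MonoidHom.range_eq_map, range_subtype]
      simp_rw [map_subgroupOf_eq_of_le (hle _)]
      rw [iSup_sup_eq, hAt, hBt]
  · intro G _ _ E hE h
    rw [sn_iff hσ] at h ⊢
    intro i
    obtain ⟨N, hN⟩ := h i
    exact frattini_hall hE hN
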